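/- arXiv:1603.09575 — 2 statements merged into one kernel-verified Lean document; each statement's English description precedes it below -/
import Mathlib

section
/- Let U be an open subset of {(r,θ,φ) : r > 0, 0 < θ < π} and Λ : U → ℝ a smooth positive function satisfying the hyperbolic Helmholtz equation Δ_{H³}Λ + Λ = 0. Define Φ¹ = (∂_rΛ)/(2Λ), Φ² = (∂_θΛ)/(2Λ sinh r), Φ³ = (∂_φΛ)/(2Λ sinh r sin θ), and gauge-potential components 𝒜¹_r = 0, 𝒜¹_θ = −(∂_φΛ)/(2Λ sin θ), 𝒜¹_φ = (1/2)(cos θ + sin θ (∂_θΛ)/Λ), 𝒜²_r = (∂_φΛ)/(2Λ sinh r sin θ), 𝒜²_θ = 0, 𝒜²_φ = −(1/2)(cosh r + sinh r (∂_rΛ)/Λ) sin θ, 𝒜³_r = −(∂_θΛ)/(2Λ sinh r), 𝒜³_θ = (1/2)(cosh r + sinh r (∂_rΛ)/Λ), 𝒜³_φ = 0. Then (Φᵃ, 𝒜ᵃ_μ) satisfies the Bogomolny equations on U: for each a = 1,2,3, D_rΦᵃ = −Fᵃ_{θφ}/(sinh²r sin θ), D_θΦᵃ = Fᵃ_{rφ}/sin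 θ, and D_φΦᵃ = −sin θ · Fᵃ_{rθ}. -/
noncomputable section

/-- Partial derivative in the radial coordinate `r`. -/
def pdr (f : ℝ → ℝ → ℝ → ℝ) (r θ φ : ℝ) : ℝ := deriv (fun t => f t θ φ) r

/-- Partial derivative in the polar coordinate `θ`. -/
def pdθ (f : ℝ → ℝ → ℝ → ℝ) (r θ φ : ℝ) : ℝ := deriv (fun t => f r t φ) θ

/-- Partial derivative in the azimuthal coordinate `φ`. -/
def pdφ (f : ℝ → ℝ → ℝ → ℝ) (r θ φ : ℝ) : ℝ := deriv (fun t => f r θ t) φ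

/-- Hyperbolic Laplacian in hyperboloid-model coordinates `(r,θ,φ)`. -/
def lapH3 (f : ℝ → ℝ → ℝ → ℝ) (r θ φ : ℝ) : ℝ :=
  pdr (pdr f) r θ φ + 2 * (Real.cosh r / Real.sinh r) * pdr f r θ φ
    + (1 / Real.sinh r ^ 2)
      * (pdθ (pdθ f) r θ φ + (Real.cos θ / Real.sin θ) * pdθ f r θ φ
        + (1 / Real.sin θ ^ 2) * pdφ (pdφ f) r θ φ)

/-- Higgs field components generated by a Helmholtz solution `Λ`. -/
def Phi1 (Λ : ℝ → ℝ → ℝ → ℝ) : ℝ → ℝ → ℝ → ℝ := fun r θ φ =>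
  pdr Λ r θ φ / (2 * Λ r θ φ)

def Phi2 (Λ : ℝ → ℝ → ℝ → ℝ) : ℝ → ℝ → ℝ → ℝ := fun r θ φ =>
  pdθ Λ r θ φ / (2 * Λ r θ φ * Real.sinh r)

def Phi3 (Λ : ℝ → ℝ → ℝ → ℝ) : ℝ → ℝ → ℝ → ℝ := fun r θ φ =>
  pdφ Λ r θ φ / (2 * Λ r θ φ * Real.sinh r * Real.sin θ)

/-- Gauge potential components generated by a Helmholtz solution `Λ`. -/
def A1r (_ : ℝ → ℝ → ℝ → ℝ) : ℝ → ℝ → ℝ → ℝ := fun _ _ _ => 0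

def A1θ (Λ : ℝ → ℝ → ℝ → ℝ) : ℝ → ℝ → ℝ → ℝ := fun r θ φ =>
  -(pdφ Λ r θ φ) / (2 * Λ r θ φ * Real.sin θ)

def A1φ (Λ : ℝ → ℝ → ℝ → ℝ) : ℝ → ℝ → ℝ → ℝ := fun r θ φ =>
  (1 / 2) * (Real.cos θ + Real.sin θ * pdθ Λ r θ φ / Λ r θ φ)

def A2r (Λ : ℝ → ℝ → ℝ → ℝ) : ℝ → ℝ → ℝ → ℝ := fun r θ φ =>
  pdφ Λ r θ φ / (2 * Λ r θ φ * Real.sinh r * Real.sin θ)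

def A2θ (_ : ℝ → ℝ → ℝ → ℝ) : ℝ → ℝ → ℝ → ℝ := fun _ _ _ => 0

def A2φ (Λ : ℝ → ℝ → ℝ → ℝ) : ℝ → ℝ → ℝ → ℝ := fun r θ φ =>
  -(1 / 2) * (Real.cosh r + Real.sinh r * pdr Λ r θ φ / Λ r θ φ) * Real.sin θ

def A3r (Λ : ℝ → ℝ → ℝ → ℝ) : ℝ → ℝ → ℝ → ℝ := fun r θ φ =>
  -(pdθ Λ r θ φ) / (2 * Λ r θ φ * Real.sinh r)

def A3θ (Λ : ℝ → ℝ → ℝ → ℝ) : ℝ → ℝ → ℝ → ℝ := fun r θ φ =>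
  (1 / 2) * (Real.cosh r + Real.sinh r * pdr Λ r θ φ / Λ r θ φ)

def A3φ (_ : ℝ → ℝ → ℝ → ℝ) : ℝ → ℝ → ℝ → ℝ := fun _ _ _ => 0

/-- Covariant derivatives `D_μΦᵃ = ∂_μΦᵃ + 2 ε_{abc}𝒜ᵇ_μΦᶜ`. -/
def D1r (Λ : ℝ → ℝ → ℝ → ℝ) (r θ φ : ℝ) : ℝ :=
  pdr (Phi1 Λ) r θ φ + 2 * (A2r Λ r θ φ * Phi3 Λ r θ φ - A3r Λ r θ φ * Phi2 Λ r θ φ)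
def D1θ (Λ : ℝ → ℝ → ℝ → ℝ) (r θ φ : ℝ) : ℝ :=
  pdθ (Phi1 Λ) r θ φ + 2 * (A2θ Λ r θ φ * Phi3 Λ r θ φ - A3θ Λ r θ φ * Phi2 Λ r θ φ)
def D1φ (Λ : ℝ → ℝ → ℝ → ℝ) (r θ φ : ℝ) : ℝ :=
  pdφ (Phi1 Λ) r θ φ + 2 * (A2φ Λ r θ φ * Phi3 Λ r θ φ - A3φ Λ r θ φ * Phi2 Λ r θ φ)
def D2r (Λ : ℝ → ℝ → ℝ → ℝ) (r θ φ : ℝ) : ℝ :=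
  pdr (Phi2 Λ) r θ φ + 2 * (A3r Λ r θ φ * Phi1 Λ r θ φ - A1r Λ r θ φ * Phi3 Λ r θ φ)
def D2θ (Λ : ℝ → ℝ → ℝ → ℝ) (r θ φ : ℝ) : ℝ :=
  pdθ (Phi2 Λ) r θ φ + 2 * (A3θ Λ r θ φ * Phi1 Λ r θ φ - A1θ Λ r θ φ * Phi3 Λ r θ φ)
def D2φ (Λ : ℝ → ℝ → ℝ → ℝ) (r θ φ : ℝ) : ℝ :=
  pdφ (Phi2 Λ) r θ φ + 2 * (A3φ Λ r θ φ * Phi1 Λ r θ φ - A1φ Λ r θ φ * Phi3 Λ r θ φ)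
def D3r (Λ : ℝ → ℝ → ℝ → ℝ) (r θ φ : ℝ) : ℝ :=
  pdr (Phi3 Λ) r θ φ + 2 * (A1r Λ r θ φ * Phi2 Λ r θ φ - A2r Λ r θ φ * Phi1 Λ r θ φ)
def D3θ (Λ : ℝ → ℝ → ℝ → ℝ) (r θ φ : ℝ) : ℝ :=
  pdθ (Phi3 Λ) r θ φ + 2 * (A1θ Λ r θ φ * Phi2 Λ r θ φ - A2θ Λ r θ φ * Phi1 Λ r θ φ)
def D3φ (Λ : ℝ → ℝ → ℝ → ℝ) (r θ φ : ℝ) : ℝ :=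
  pdφ (Phi3 Λ) r θ φ + 2 * (A1φ Λ r θ φ * Phi2 Λ r θ φ - A2φ Λ r θ φ * Phi1 Λ r θ φ)

/-- Field strength components `Fᵃ_{μν} = ∂_μ𝒜ᵃ_ν − ∂_ν𝒜ᵃ_μ + 2 ε_{abc}𝒜ᵇ_μ𝒜ᶜ_ν`. -/
def F1θφ (Λ : ℝ → ℝ → ℝ → ℝ) (r θ φ : ℝ) : ℝ :=
  pdθ (A1φ Λ) r θ φ - pdφ (A1θ Λ) r θ φ
    + 2 * (A2θ Λ r θ φ * A3φ Λ r θ φ - A3θ Λ r θ φ * A2φ Λ r θ φ)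
def F1rφ (Λ : ℝ → ℝ → ℝ → ℝ) (r θ φ : ℝ) : ℝ :=
  pdr (A1φ Λ) r θ φ - pdφ (A1r Λ) r θ φ
    + 2 * (A2r Λ r θ φ * A3φ Λ r θ φ - A3r Λ r θ φ * A2φ Λ r θ φ)
def F1rθ (Λ : ℝ → ℝ → ℝ → ℝ) (r θ φ : ℝ) : ℝ :=
  pdr (A1θ Λ) r θ φ - pdθ (A1r Λ) r θ φ
    + 2 * (A2r Λ r θ φ * A3θ Λ r θ φ - A3r Λ r θ φ * A2θ Λ r θ φ)
def F2θφ (Λ : ℝ → ℝ → ℝ → ℝ) (r θ φ : ℝ) : ℝ :=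
  pdθ (A2φ Λ) r θ φ - pdφ (A2θ Λ) r θ φ
    + 2 * (A3θ Λ r θ φ * A1φ Λ r θ φ - A1θ Λ r θ φ * A3φ Λ r θ φ)
def F2rφ (Λ : ℝ → ℝ → ℝ → ℝ) (r θ φ : ℝ) : ℝ :=
  pdr (A2φ Λ) r θ φ - pdφ (A2r Λ) r θ φ
    + 2 * (A3r Λ r θ φ * A1φ Λ r θ φ - A1r Λ r θ φ * A3φ Λ r θ φ)
def F2rθ (Λ : ℝ → ℝ → ℝ → ℝ) (r θ φ : ℝ) : ℝ :=
  pdr (A2θ Λ) r θ φ - pdθ (A2r Λ) r θ φ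
    + 2 * (A3r Λ r θ φ * A1θ Λ r θ φ - A1r Λ r θ φ * A3θ Λ r θ φ)
def F3θφ (Λ : ℝ → ℝ → ℝ → ℝ) (r θ φ : ℝ) : ℝ :=
  pdθ (A3φ Λ) r θ φ - pdφ (A3θ Λ) r θ φ
    + 2 * (A1θ Λ r θ φ * A2φ Λ r θ φ - A2θ Λ r θ φ * A1φ Λ r θ φ)
def F3rφ (Λ : ℝ → ℝ → ℝ → ℝ) (r θ φ : ℝ) : ℝ :=
  pdr (A3φ Λ) r θ φ - pdφ (A3r Λ) r θ φ
    + 2 * (A1r Λ r θ φ * A2φ Λ r θ φ - A2r Λ r θ φ * A1φ Λ r θ φ)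
def F3rθ (Λ : ℝ → ℝ → ℝ → ℝ) (r θ φ : ℝ) : ℝ :=
  pdr (A3θ Λ) r θ φ - pdθ (A3r Λ) r θ φ
    + 2 * (A1r Λ r θ φ * A2θ Λ r θ φ - A2r Λ r θ φ * A1θ Λ r θ φ)

/-- The function on `ℝ × ℝ × ℝ` underlying a function of three real variables. -/
def uncurry3 (f : ℝ → ℝ → ℝ → ℝ) : ℝ × ℝ × ℝ → ℝ := fun p => f p.1 p.2.1 p.2.2

section PartialDerivatives

variable {f : ℝ → ℝ → ℝ → ℝ} {r θ φ : ℝ}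

theorem hasDerivAt_fst_of_differentiableAt (hf : DifferentiableAt ℝ (uncurry3 f) (r, θ, φ)) :
    HasDerivAt (fun t => f t θ φ) (fderiv ℝ (uncurry3 f) (r, θ, φ) (1, 0, 0)) r :=
  HasFDerivAt.comp_hasDerivAt (f := fun t : ℝ => (t, θ, φ)) r hf.hasFDerivAt
    ((hasDerivAt_id r).prodMk ((hasDerivAt_const r θ).prodMk (hasDerivAt_const r φ)))

theorem hasDerivAt_snd_of_differentiableAt (hf : DifferentiableAt ℝ (uncurry3 f) (r, θ, φ)) :
    HasDerivAt (fun t => f r t φ) (fderiv ℝ (uncurry3 f) (r, θ, φ) (0, 1, 0)) θ :=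
  HasFDerivAt.comp_hasDerivAt (f := fun t : ℝ => (r, t, φ)) θ hf.hasFDerivAt
    ((hasDerivAt_const θ r).prodMk ((hasDerivAt_id θ).prodMk (hasDerivAt_const θ φ)))

theorem hasDerivAt_thd_of_differentiableAt (hf : DifferentiableAt ℝ (uncurry3 f) (r, θ, φ)) :
    HasDerivAt (fun t => f r θ t) (fderiv ℝ (uncurry3 f) (r, θ, φ) (0, 0, 1)) φ :=
  HasFDerivAt.comp_hasDerivAt (f := fun t : ℝ => (r, θ, t)) φ hf.hasFDerivAt
    ((hasDerivAt_const φ r).prodMk ((hasDerivAt_const φ θ).prodMk (hasDerivAt_id φ)))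

theorem pdr_eq_fderiv (hf : DifferentiableAt ℝ (uncurry3 f) (r, θ, φ)) :
    pdr f r θ φ = fderiv ℝ (uncurry3 f) (r, θ, φ) (1, 0, 0) :=
  (hasDerivAt_fst_of_differentiableAt hf).deriv

theorem pdθ_eq_fderiv (hf : DifferentiableAt ℝ (uncurry3 f) (r, θ, φ)) :
    pdθ f r θ φ = fderiv ℝ (uncurry3 f) (r, θ, φ) (0, 1, 0) :=
  (hasDerivAt_snd_of_differentiableAt hf).deriv

theorem pdφ_eq_fderiv (hf : DifferentiableAt ℝ (uncurry3 f) (r, θ, φ)) :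
    pdφ f r θ φ = fderiv ℝ (uncurry3 f) (r, θ, φ) (0, 0, 1) :=
  (hasDerivAt_thd_of_differentiableAt hf).deriv

theorem hasDerivAt_pdr (hf : DifferentiableAt ℝ (uncurry3 f) (r, θ, φ)) :
    HasDerivAt (fun t => f t θ φ) (pdr f r θ φ) r :=
  (hasDerivAt_fst_of_differentiableAt hf).differentiableAt.hasDerivAt

theorem hasDerivAt_pdθ (hf : DifferentiableAt ℝ (uncurry3 f) (r, θ, φ)) :
    HasDerivAt (fun t => f r t φ) (pdθ f r θ φ) θ :=
  (hasDerivAt_snd_of_differentiableAt hf).differentiableAt.hasDerivAt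

theorem hasDerivAt_pdφ (hf : DifferentiableAt ℝ (uncurry3 f) (r, θ, φ)) :
    HasDerivAt (fun t => f r θ t) (pdφ f r θ φ) φ :=
  (hasDerivAt_thd_of_differentiableAt hf).differentiableAt.hasDerivAt

end PartialDerivatives

section SecondPartialDerivatives

variable {f : ℝ → ℝ → ℝ → ℝ} {p : ℝ × ℝ × ℝ}

theorem uncurry3_pdr_eventuallyEq (hf : ContDiffAt ℝ 2 (uncurry3 f) p) :
    uncurry3 (pdr f) =ᶠ[nhds p] fun q => fderiv ℝ (uncurry3 f) q (1, 0, 0) :=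
  (hf.eventually (by simp)).mono fun _ hq => pdr_eq_fderiv (hq.differentiableAt (by simp))

theorem uncurry3_pdθ_eventuallyEq (hf : ContDiffAt ℝ 2 (uncurry3 f) p) :
    uncurry3 (pdθ f) =ᶠ[nhds p] fun q => fderiv ℝ (uncurry3 f) q (0, 1, 0) :=
  (hf.eventually (by simp)).mono fun _ hq => pdθ_eq_fderiv (hq.differentiableAt (by simp))

theorem uncurry3_pdφ_eventuallyEq (hf : ContDiffAt ℝ 2 (uncurry3 f) p) :
    uncurry3 (pdφ f) =ᶠ[nhds p] fun q => fderiv ℝ (uncurry3 f) q (0, 0, 1) :=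
  (hf.eventually (by simp)).mono fun _ hq => pdφ_eq_fderiv (hq.differentiableAt (by simp))

theorem hasFDerivAt_fderiv_apply {E : Type*} [NormedAddCommGroup E] [NormedSpace ℝ E]
    {g : E → ℝ} {x : E} (hg : ContDiffAt ℝ 2 g x) (v : E) :
    HasFDerivAt (fun y => fderiv ℝ g y v) ((fderiv ℝ (fderiv ℝ g) x).flip v) x :=
  (((hg.fderiv_right (m := 1) (by norm_num)).differentiableAt (by simp)).hasFDerivAt).clm_apply
    (hasFDerivAt_const v x) |>.congr_fderiv (by ext; simp)

theorem hasFDerivAt_uncurry3_pdr (hf : ContDiffAt ℝ 2 (uncurry3 f) p) :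
    HasFDerivAt (uncurry3 (pdr f)) ((fderiv ℝ (fderiv ℝ (uncurry3 f)) p).flip (1, 0, 0)) p :=
  (hasFDerivAt_fderiv_apply hf _).congr_of_eventuallyEq (uncurry3_pdr_eventuallyEq hf)

theorem hasFDerivAt_uncurry3_pdθ (hf : ContDiffAt ℝ 2 (uncurry3 f) p) :
    HasFDerivAt (uncurry3 (pdθ f)) ((fderiv ℝ (fderiv ℝ (uncurry3 f)) p).flip (0, 1, 0)) p :=
  (hasFDerivAt_fderiv_apply hf _).congr_of_eventuallyEq (uncurry3_pdθ_eventuallyEq hf)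

theorem hasFDerivAt_uncurry3_pdφ (hf : ContDiffAt ℝ 2 (uncurry3 f) p) :
    HasFDerivAt (uncurry3 (pdφ f)) ((fderiv ℝ (fderiv ℝ (uncurry3 f)) p).flip (0, 0, 1)) p :=
  (hasFDerivAt_fderiv_apply hf _).congr_of_eventuallyEq (uncurry3_pdφ_eventuallyEq hf)

theorem isSymmSndFDerivAt_uncurry3 (hf : ContDiffAt ℝ 2 (uncurry3 f) p) :
    IsSymmSndFDerivAt ℝ (uncurry3 f) p :=
  hf.isSymmSndFDerivAt (by simp)

variable {r θ φ : ℝ}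

theorem pdθ_pdr_comm (hf : ContDiffAt ℝ 2 (uncurry3 f) (r, θ, φ)) :
    pdθ (pdr f) r θ φ = pdr (pdθ f) r θ φ := by
  have h₁ := hasFDerivAt_uncurry3_pdr hf
  have h₂ := hasFDerivAt_uncurry3_pdθ hf
  rw [pdθ_eq_fderiv h₁.differentiableAt, pdr_eq_fderiv h₂.differentiableAt, h₁.fderiv, h₂.fderiv]
  exact isSymmSndFDerivAt_uncurry3 hf _ _

theorem pdφ_pdr_comm (hf : ContDiffAt ℝ 2 (uncurry3 f) (r, θ, φ)) :
    pdφ (pdr f) r θ φ = pdr (pdφ f) r θ φ := by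
  have h₁ := hasFDerivAt_uncurry3_pdr hf
  have h₂ := hasFDerivAt_uncurry3_pdφ hf
  rw [pdφ_eq_fderiv h₁.differentiableAt, pdr_eq_fderiv h₂.differentiableAt, h₁.fderiv, h₂.fderiv]
  exact isSymmSndFDerivAt_uncurry3 hf _ _

theorem pdφ_pdθ_comm (hf : ContDiffAt ℝ 2 (uncurry3 f) (r, θ, φ)) :
    pdφ (pdθ f) r θ φ = pdθ (pdφ f) r θ φ := by
  have h₁ := hasFDerivAt_uncurry3_pdθ hf
  have h₂ := hasFDerivAt_uncurry3_pdφ hf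
  rw [pdφ_eq_fderiv h₁.differentiableAt, pdθ_eq_fderiv h₂.differentiableAt, h₁.fderiv, h₂.fderiv]
  exact isSymmSndFDerivAt_uncurry3 hf _ _

end SecondPartialDerivatives

/-- A smooth positive solution `Λ` of the hyperbolic Helmholtz equation generates,
via `(Φᵃ, 𝒜ᵃ_μ)` as above, a solution of the Bogomolny equations on hyperbolic
3-space in hyperboloid coordinates. -/
theorem helmholtz_generates_bogomolny (U : Set (ℝ × ℝ × ℝ)) (hU : IsOpen U)
    (hUreg : ∀ p ∈ U, 0 < p.1 ∧ p.2.1 ∈ Set.Ioo 0 Real.pi)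
    (Λ : ℝ → ℝ → ℝ → ℝ)
    (hΛ : ContDiffOn ℝ (⊤ : ℕ∞) (fun p : ℝ × ℝ × ℝ => Λ p.1 p.2.1 p.2.2) U)
    (hΛpos : ∀ p ∈ U, 0 < Λ p.1 p.2.1 p.2.2)
    (hHelm : ∀ p ∈ U, lapH3 Λ p.1 p.2.1 p.2.2 + Λ p.1 p.2.1 p.2.2 = 0) :
    ∀ p ∈ U, ∀ r θ φ : ℝ, p = (r, θ, φ) →
      (D1r Λ r θ φ = -(F1θφ Λ r θ φ) / (Real.sinh r ^ 2 * Real.sin θ) ∧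
       D1θ Λ r θ φ = F1rφ Λ r θ φ / Real.sin θ ∧
       D1φ Λ r θ φ = -(Real.sin θ) * F1rθ Λ r θ φ) ∧
      (D2r Λ r θ φ = -(F2θφ Λ r θ φ) / (Real.sinh r ^ 2 * Real.sin θ) ∧
       D2θ Λ r θ φ = F2rφ Λ r θ φ / Real.sin θ ∧
       D2φ Λ r θ φ = -(Real.sin θ) * F2rθ Λ r θ φ) ∧
      (D3r Λ r θ φ = -(F3θφ Λ r θ φ) / (Real.sinh r ^ 2 * Real.sin θ) ∧
       D3θ Λ r θ φ = F3rφ Λ r θ φ / Real.sin θ ∧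
       D3φ Λ r θ φ = -(Real.sin θ) * F3rθ Λ r θ φ) := by
  rintro p hp r θ φ rfl
  have hC : ContDiffAt ℝ 2 (uncurry3 Λ) (r, θ, φ) :=
    (hΛ.contDiffAt (hU.mem_nhds hp)).of_le (WithTop.coe_le_coe.2 le_top)
  have hD : DifferentiableAt ℝ (uncurry3 Λ) (r, θ, φ) := hC.differentiableAt (by simp)
  have hDr := (hasFDerivAt_uncurry3_pdr hC).differentiableAt
  have hDθ := (hasFDerivAt_uncurry3_pdθ hC).differentiableAt
  have hDφ := (hasFDerivAt_uncurry3_pdφ hC).differentiableAt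
  have hL : Λ r θ φ ≠ 0 := (hΛpos _ hp).ne'
  have hS : Real.sinh r ≠ 0 := (Real.sinh_pos_iff.2 (hUreg _ hp).1).ne'
  have hs : Real.sin θ ≠ 0 := (Real.sin_pos_of_mem_Ioo (hUreg _ hp).2).ne'
  have hL2 : 2 * Λ r θ φ ≠ 0 := mul_ne_zero two_ne_zero hL
  have hLS : 2 * Λ r θ φ * Real.sinh r ≠ 0 := mul_ne_zero hL2 hS
  have hLs : 2 * Λ r θ φ * Real.sin θ ≠ 0 := mul_ne_zero hL2 hs
  have hLSs : 2 * Λ r θ φ * Real.sinh r * Real.sin θ ≠ 0 := mul_ne_zero hLS hs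
  have hsinh := Real.hasDerivAt_sinh r
  have hcosh := Real.hasDerivAt_cosh r
  have hsin := Real.hasDerivAt_sin θ
  have hcos := Real.hasDerivAt_cos θ
  have dr := hasDerivAt_pdr hD
  have drr := hasDerivAt_pdr hDr
  have drθ := hasDerivAt_pdr hDθ
  have drφ := hasDerivAt_pdr hDφ
  have dθ := hasDerivAt_pdθ hD
  have dθr := hasDerivAt_pdθ hDr
  have dθθ := hasDerivAt_pdθ hDθ
  have dθφ := hasDerivAt_pdθ hDφ
  have dφ := hasDerivAt_pdφ hD
  have dφr := hasDerivAt_pdφ hDr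
  have dφθ := hasDerivAt_pdφ hDθ
  have dφφ := hasDerivAt_pdφ hDφ
  have erPhi1 : pdr (Phi1 Λ) r θ φ = _ :=
    (drr.div (dr.const_mul 2) hL2).deriv
  have erPhi2 : pdr (Phi2 Λ) r θ φ = _ :=
    (drθ.div ((dr.const_mul 2).mul hsinh) hLS).deriv
  have erPhi3 : pdr (Phi3 Λ) r θ φ = _ :=
    (drφ.div (((dr.const_mul 2).mul hsinh).mul_const (Real.sin θ)) hLSs).deriv
  have erA1θ : pdr (A1θ Λ) r θ φ = _ :=
    (drφ.neg.div ((dr.const_mul 2).mul_const (Real.sin θ)) hLs).deriv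
  have erA1φ : pdr (A1φ Λ) r θ φ = _ :=
    ((((drθ.const_mul (Real.sin θ)).div dr hL).const_add (Real.cos θ)).const_mul (1 / 2)).deriv
  have erA2φ : pdr (A2φ Λ) r θ φ = _ :=
    (((hcosh.add ((hsinh.mul drr).div dr hL)).const_mul (-(1 / 2))).mul_const (Real.sin θ)).deriv
  have erA3θ : pdr (A3θ Λ) r θ φ = _ :=
    ((hcosh.add ((hsinh.mul drr).div dr hL)).const_mul (1 / 2)).deriv
  have eθPhi1 : pdθ (Phi1 Λ) r θ φ = _ :=
    (dθr.div (dθ.const_mul 2) hL2).deriv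
  have eθPhi2 : pdθ (Phi2 Λ) r θ φ = _ :=
    (dθθ.div ((dθ.const_mul 2).mul_const (Real.sinh r)) hLS).deriv
  have eθPhi3 : pdθ (Phi3 Λ) r θ φ = _ :=
    (dθφ.div (((dθ.const_mul 2).mul_const (Real.sinh r)).mul hsin) hLSs).deriv
  have eθA1φ : pdθ (A1φ Λ) r θ φ = _ :=
    ((hcos.add ((hsin.mul dθθ).div dθ hL)).const_mul (1 / 2)).deriv
  have eθA2φ : pdθ (A2φ Λ) r θ φ = _ :=
    (((((dθr.const_mul (Real.sinh r)).div dθ hL).const_add (Real.cosh r)).const_mul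
      (-(1 / 2))).mul hsin).deriv
  have eθA2r : pdθ (A2r Λ) r θ φ = _ :=
    (dθφ.div (((dθ.const_mul 2).mul_const (Real.sinh r)).mul hsin) hLSs).deriv
  have eθA3r : pdθ (A3r Λ) r θ φ = _ :=
    (dθθ.neg.div ((dθ.const_mul 2).mul_const (Real.sinh r)) hLS).deriv
  have eφPhi1 : pdφ (Phi1 Λ) r θ φ = _ :=
    (dφr.div (dφ.const_mul 2) hL2).deriv
  have eφPhi2 : pdφ (Phi2 Λ) r θ φ = _ :=
    (dφθ.div ((dφ.const_mul 2).mul_const (Real.sinh r)) hLS).deriv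
  have eφPhi3 : pdφ (Phi3 Λ) r θ φ = _ :=
    (dφφ.div (((dφ.const_mul 2).mul_const (Real.sinh r)).mul_const (Real.sin θ)) hLSs).deriv
  have eφA1θ : pdφ (A1θ Λ) r θ φ = _ :=
    (dφφ.neg.div ((dφ.const_mul 2).mul_const (Real.sin θ)) hLs).deriv
  have eφA3θ : pdφ (A3θ Λ) r θ φ = _ :=
    ((((dφr.const_mul (Real.sinh r)).div dφ hL).const_add (Real.cosh r)).const_mul (1 / 2)).deriv
  have eφA2r : pdφ (A2r Λ) r θ φ = _ :=
    (dφφ.div (((dφ.const_mul 2).mul_const (Real.sinh r)).mul_const (Real.sin θ)) hLSs).deriv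
  have eφA3r : pdφ (A3r Λ) r θ φ = _ :=
    (dφθ.neg.div ((dφ.const_mul 2).mul_const (Real.sinh r)) hLS).deriv
  have eθA1r : pdθ (A1r Λ) r θ φ = 0 := deriv_const _ _
  have eφA1r : pdφ (A1r Λ) r θ φ = 0 := deriv_const _ _
  have erA2θ : pdr (A2θ Λ) r θ φ = 0 := deriv_const _ _
  have eφA2θ : pdφ (A2θ Λ) r θ φ = 0 := deriv_const _ _
  have erA3φ : pdr (A3φ Λ) r θ φ = 0 := deriv_const _ _
  have eθA3φ : pdθ (A3φ Λ) r θ φ = 0 := deriv_const _ _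
  have hH := hHelm _ hp
  have hch := Real.cosh_sq r
  have cθr := pdθ_pdr_comm hC
  have cφr := pdφ_pdr_comm hC
  have cφθ := pdφ_pdθ_comm hC
  simp only [lapH3] at hH
  simp only [D1r, D1θ, D1φ, D2r, D2θ, D2φ, D3r, D3θ, D3φ, F1θφ, F1rφ, F1rθ, F2θφ, F2rφ, F2rθ,
    F3θφ, F3rφ, F3rθ,
    erPhi1, erPhi2, erPhi3, erA1θ, erA1φ, erA2φ, erA3θ, eθPhi1, eθPhi2, eθPhi3, eθA1φ, eθA2φ,
    eθA2r, eθA3r, eφPhi1, eφPhi2, eφPhi3, eφA1θ, eφA3θ, eφA2r, eφA3r, eθA1r, eφA1r, erA2θ,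
    eφA2θ, erA3φ, eθA3φ,
    cθr, cφr, cφθ]
  simp only [Phi1, Phi2, Phi3, A1r, A1θ, A1φ, A2r, A2θ, A2φ, A3r, A3θ, A3φ,
    Pi.mul_apply, Pi.div_apply, Pi.neg_apply]
  field_simp at hH
  refine ⟨⟨?_, ?_, ?_⟩, ⟨?_, ?_, ?_⟩, ⟨?_, ?_, ?_⟩⟩
  · field_simp
    linear_combination Λ r θ φ * hH + Λ r θ φ ^ 2 * Real.sin θ ^ 2 * hch
  · field_simp
    ring
  · field_simp
    ring
  · field_simp
    ring
  · field_simp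
    linear_combination Λ r θ φ * hH
  · field_simp
    ring
  · field_simp
    ring
  · field_simp
    ring
  · field_simp
    linear_combination Λ r θ φ * hH
end
end

section
/- Let N ≥ 0 and let c₀, c₁, …, c_{N+1} be smooth functions of (θ,φ) ∈ (0,π) × ℝ satisfying the recursion c_{k+1} = c_k − (1/(k+1)²) Σ_{j=0}^{k} Δ_{S²} c_j for all 0 ≤ k ≤ N, where Δ_{S²}c = ∂²_θ c + cot θ ∂_θ c + (1/sin²θ) ∂²_φ c. Define the partial sum Λ_N(r,θ,φ) = Σ_{k=0}^{N} c_k(θ,φ) e^{−(2k+1)r}. Then for all r > 0: sinh²r (∂²_r Λ_N + 2 coth r ∂_r Λ_N + Λ_N) + Δ_{S²} Λ_N = (N+1)² ( c_N e^{−(2N+3)r} − c_{N+1} e^{−(2N+1)r} ). In particular, the error in the hyperbolic Helmholtz equation for the partial sum is exactly of order e^{−(2N+1)r} in terms determined by c_N and c_{N+1}. -/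
noncomputable section

/-- Partial derivative of a function of `(θ,φ)` in `θ`. -/
def pdθ2 (f : ℝ → ℝ → ℝ) (θ φ : ℝ) : ℝ := deriv (fun t => f t φ) θ

/-- Partial derivative of a function of `(θ,φ)` in `φ`. -/
def pdφ2 (f : ℝ → ℝ → ℝ) (θ φ : ℝ) : ℝ := deriv (fun t => f θ t) φ

/-- Laplacian on the unit 2-sphere in coordinates:
`Δ_{S²}c = ∂²_θc + cot θ ∂_θc + (1/sin²θ)∂²_φc`. -/
def lapS2 (f : ℝ → ℝ → ℝ) (θ φ : ℝ) : ℝ :=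
  pdθ2 (pdθ2 f) θ φ + (Real.cos θ / Real.sin θ) * pdθ2 f θ φ
    + (1 / Real.sin θ ^ 2) * pdφ2 (pdφ2 f) θ φ

lemma deriv_sum_mul_const {ι : Type*} {F : Finset ι} {s : Set ℝ} (hs : IsOpen s)
    {f : ι → ℝ → ℝ} {a : ι → ℝ} (hf : ∀ i ∈ F, ContDiffOn ℝ 2 (f i) s) {x : ℝ} (hx : x ∈ s) :
    deriv (fun t => ∑ i ∈ F, f i t * a i) x = ∑ i ∈ F, deriv (f i) x * a i := by
  have hd : ∀ i ∈ F, DifferentiableAt ℝ (f i) x := fun i hi =>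
    ((hf i hi).differentiableOn (by norm_num)).differentiableAt (hs.mem_nhds hx)
  exact (HasDerivAt.fun_sum fun i hi => (hd i hi).hasDerivAt.mul_const (a i)).deriv

lemma deriv_deriv_sum_mul_const {ι : Type*} {F : Finset ι} {s : Set ℝ} (hs : IsOpen s)
    {f : ι → ℝ → ℝ} {a : ι → ℝ} (hf : ∀ i ∈ F, ContDiffOn ℝ 2 (f i) s) {x : ℝ} (hx : x ∈ s) :
    deriv (deriv fun t => ∑ i ∈ F, f i t * a i) x = ∑ i ∈ F, deriv (deriv (f i)) x * a i := by
  have heq : (deriv fun t => ∑ i ∈ F, f i t * a i) =ᶠ[nhds x]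
      fun t => ∑ i ∈ F, deriv (f i) t * a i := by
    filter_upwards [hs.mem_nhds hx] with t ht using deriv_sum_mul_const hs hf ht
  rw [heq.deriv_eq]
  have hd : ∀ i ∈ F, DifferentiableAt ℝ (deriv (f i)) x := fun i hi =>
    (((hf i hi).deriv_of_isOpen (m := 1) hs (by norm_num)).differentiableOn
      (by norm_num)).differentiableAt (hs.mem_nhds hx)
  exact (HasDerivAt.fun_sum fun i hi => (hd i hi).hasDerivAt.mul_const (a i)).deriv

lemma deriv_exp_mul (m : ℝ) :
    (deriv fun t : ℝ => Real.exp (m * t)) = fun t => m * Real.exp (m * t) := by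
  funext t
  have h := ((hasDerivAt_id t).const_mul m).exp
  simpa [mul_comm] using h.deriv

lemma deriv_deriv_exp_mul (m : ℝ) :
    (deriv (deriv fun t : ℝ => Real.exp (m * t))) = fun t => m ^ 2 * Real.exp (m * t) := by
  funext t
  rw [deriv_exp_mul, deriv_const_mul_field, deriv_exp_mul]
  ring

/-- The action of the radial part of the Helmholtz operator on `e^{-(2k+1)r}`. -/
lemma radial_helmholtz_exp {r : ℝ} (hr : 0 < r) (k : ℝ) :
    Real.sinh r ^ 2 * ((-(2 * k + 1)) ^ 2 + 2 * (Real.cosh r / Real.sinh r) * (-(2 * k + 1)) + 1)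
      = k ^ 2 * Real.exp (2 * r) - (2 * k ^ 2 + 2 * k + 1)
        + (k + 1) ^ 2 * Real.exp (-(2 * r)) := by
  have hs : Real.sinh r ≠ 0 := (Real.sinh_pos_iff.2 hr).ne'
  have h1 : Real.exp (2 * r) = Real.exp r ^ 2 := by rw [← Real.exp_nat_mul]; norm_num
  have h2 : Real.exp (-(2 * r)) = Real.exp (-r) ^ 2 := by
    rw [← Real.exp_nat_mul]; congr 1; push_cast; ring
  have h3 : Real.exp r * Real.exp (-r) = 1 := by rw [← Real.exp_add]; simp
  have h4 : Real.sinh r ^ 2 *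
      ((-(2 * k + 1)) ^ 2 + 2 * (Real.cosh r / Real.sinh r) * (-(2 * k + 1)) + 1)
      = Real.sinh r ^ 2 * ((2 * k + 1) ^ 2 + 1)
        - 2 * (2 * k + 1) * (Real.sinh r * Real.cosh r) := by
    field_simp
    ring
  rw [h4, h1, h2, Real.sinh_eq, Real.cosh_eq]
  linear_combination (-(2 * k ^ 2 + 2 * k + 1)) * h3

/-- Telescoping of the Helmholtz operator along the recursion, with `l k` in the role of
`Δ_{S²} c_k`. -/
lemma sum_helmholtz_eq (r : ℝ) (c l : ℕ → ℝ) (N : ℕ)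
    (hrec : ∀ k ≤ N, c (k + 1) = c k
      - (1 / ((k : ℝ) + 1) ^ 2) * ∑ j ∈ Finset.range (k + 1), l j) :
    ∑ k ∈ Finset.range (N + 1), (c k * ((k : ℝ) ^ 2 * Real.exp (2 * r)
        - (2 * (k : ℝ) ^ 2 + 2 * k + 1) + ((k : ℝ) + 1) ^ 2 * Real.exp (-(2 * r))) + l k)
          * Real.exp (-(2 * (k : ℝ) + 1) * r)
      = ((N : ℝ) + 1) ^ 2
          * (c N * Real.exp (-(2 * (N : ℝ) + 3) * r)
            - c (N + 1) * Real.exp (-(2 * (N : ℝ) + 1) * r)) := by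
  have hsum : ∀ k ≤ N, ∑ j ∈ Finset.range (k + 1), l j
      = ((k : ℝ) + 1) ^ 2 * (c k - c (k + 1)) := by
    intro k hk
    have : ((k : ℝ) + 1) ≠ 0 := by positivity
    rw [hrec k hk]
    field_simp
    ring
  have hdown : ∀ m : ℝ, Real.exp (-(2 * m + 3) * r)
      = Real.exp (-(2 * r)) * Real.exp (-(2 * m + 1) * r) := by
    intro m; rw [← Real.exp_add]; congr 1; ring
  have hinv : Real.exp (2 * r) * Real.exp (-(2 * r)) = 1 := by rw [← Real.exp_add]; simp
  induction N with
  | zero =>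
    have h := hsum 0 le_rfl
    simp only [zero_add, Finset.sum_range_one, Nat.cast_zero] at h ⊢
    rw [hdown, h]
    ring
  | succ n ih =>
    rw [Finset.sum_range_succ, ih (fun k hk => hrec k (by omega)) (fun k hk => hsum k (by omega))]
    have h1 := hsum (n + 1) le_rfl
    rw [Finset.sum_range_succ, hsum n (by omega)] at h1
    have h2 : Real.exp (-(2 * ((n + 1 : ℕ) : ℝ) + 1) * r)
        = Real.exp (-(2 * r)) * Real.exp (-(2 * (n : ℝ) + 1) * r) := by
      rw [← hdown]; congr 1; push_cast; ring
    rw [hdown, hdown, h2]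
    push_cast at h1 ⊢
    linear_combination
      (Real.exp (-(2 * r)) * Real.exp (-(2 * (n : ℝ) + 1) * r)) * h1
      + (c (n + 1) * ((n : ℝ) + 1) ^ 2 * Real.exp (-(2 * (n : ℝ) + 1) * r)) * hinv

/-- The partial sums `Λ_N = Σ_{k=0}^N c_k(θ,φ)e^{−(2k+1)r}` of the boundary expansion,
with coefficients obeying the recursion `c_{k+1} = c_k − (1/(k+1)²)Σ_{j≤k}Δ_{S²}c_j`,
satisfy the hyperbolic Helmholtz equation up to an explicit error of order
`e^{−(2N+1)r}` determined by `c_N` and `c_{N+1}`. -/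
theorem helmholtz_partial_sum_recursion (N : ℕ) (c : ℕ → ℝ → ℝ → ℝ)
    (hc : ∀ k ≤ N + 1, ContDiffOn ℝ (⊤ : ℕ∞) (fun p : ℝ × ℝ => c k p.1 p.2)
      ((Set.Ioo 0 Real.pi) ×ˢ (Set.univ : Set ℝ)))
    (hrec : ∀ k ≤ N, ∀ θ ∈ Set.Ioo 0 Real.pi, ∀ φ : ℝ,
      c (k + 1) θ φ = c k θ φ
        - (1 / ((k : ℝ) + 1) ^ 2) * ∑ j ∈ Finset.range (k + 1), lapS2 (c j) θ φ) :
    let Λ : ℝ → ℝ → ℝ → ℝ := fun r θ φ =>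
      ∑ k ∈ Finset.range (N + 1), c k θ φ * Real.exp (-(2 * (k : ℝ) + 1) * r)
    ∀ r : ℝ, 0 < r → ∀ θ ∈ Set.Ioo 0 Real.pi, ∀ φ : ℝ,
      Real.sinh r ^ 2 * (pdr (pdr Λ) r θ φ
          + 2 * (Real.cosh r / Real.sinh r) * pdr Λ r θ φ + Λ r θ φ)
        + (pdθ (pdθ Λ) r θ φ + (Real.cos θ / Real.sin θ) * pdθ Λ r θ φ
          + (1 / Real.sin θ ^ 2) * pdφ (pdφ Λ) r θ φ)
      = ((N : ℝ) + 1) ^ 2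
          * (c N θ φ * Real.exp (-(2 * (N : ℝ) + 3) * r)
            - c (N + 1) θ φ * Real.exp (-(2 * (N : ℝ) + 1) * r)) := by
  intro Λ r hr θ hθ φ
  have hc2 : ∀ k ∈ Finset.range (N + 1), ContDiffOn ℝ 2 (fun p : ℝ × ℝ => c k p.1 p.2)
      ((Set.Ioo 0 Real.pi) ×ˢ (Set.univ : Set ℝ)) := fun k hk =>
    (hc k (Finset.mem_range.1 hk).le).of_le (WithTop.coe_le_coe.2 le_top)
  have hcθ : ∀ k ∈ Finset.range (N + 1),
      ContDiffOn ℝ 2 (fun t => c k t φ) (Set.Ioo 0 Real.pi) := fun k hk =>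
    (hc2 k hk).comp (f := fun t : ℝ => (t, φ)) (by fun_prop) fun t ht => ⟨ht, trivial⟩
  have hcφ : ∀ k ∈ Finset.range (N + 1), ContDiffOn ℝ 2 (fun t => c k θ t) Set.univ :=
    fun k hk =>
      (hc2 k hk).comp (f := fun t : ℝ => (θ, t)) (by fun_prop) fun t _ => ⟨hθ, trivial⟩
  have hexp : ∀ k ∈ Finset.range (N + 1),
      ContDiffOn ℝ 2 (fun t : ℝ => Real.exp (-(2 * (k : ℝ) + 1) * t)) Set.univ :=
    fun k _ => by fun_prop
  have hΛr : (fun t => Λ t θ φ) = fun t =>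
      ∑ k ∈ Finset.range (N + 1), Real.exp (-(2 * (k : ℝ) + 1) * t) * c k θ φ := by
    funext t
    exact Finset.sum_congr rfl fun k _ => mul_comm _ _
  have hr1 : pdr Λ r θ φ = ∑ k ∈ Finset.range (N + 1),
      (-(2 * (k : ℝ) + 1) * Real.exp (-(2 * (k : ℝ) + 1) * r)) * c k θ φ := by
    rw [pdr, hΛr, deriv_sum_mul_const isOpen_univ hexp (Set.mem_univ r)]
    simp only [deriv_exp_mul]
  have hr2 : pdr (pdr Λ) r θ φ = ∑ k ∈ Finset.range (N + 1),
      ((-(2 * (k : ℝ) + 1)) ^ 2 * Real.exp (-(2 * (k : ℝ) + 1) * r)) * c k θ φ := by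
    change deriv (deriv fun t => Λ t θ φ) r = _
    rw [hΛr, deriv_deriv_sum_mul_const isOpen_univ hexp (Set.mem_univ r)]
    simp only [deriv_deriv_exp_mul]
  have hθ1 : pdθ Λ r θ φ = ∑ k ∈ Finset.range (N + 1),
      pdθ2 (c k) θ φ * Real.exp (-(2 * (k : ℝ) + 1) * r) :=
    deriv_sum_mul_const isOpen_Ioo hcθ hθ
  have hθ2 : pdθ (pdθ Λ) r θ φ = ∑ k ∈ Finset.range (N + 1),
      pdθ2 (pdθ2 (c k)) θ φ * Real.exp (-(2 * (k : ℝ) + 1) * r) :=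
    deriv_deriv_sum_mul_const isOpen_Ioo hcθ hθ
  have hφ2 : pdφ (pdφ Λ) r θ φ = ∑ k ∈ Finset.range (N + 1),
      pdφ2 (pdφ2 (c k)) θ φ * Real.exp (-(2 * (k : ℝ) + 1) * r) :=
    deriv_deriv_sum_mul_const isOpen_univ hcφ (Set.mem_univ φ)
  rw [← sum_helmholtz_eq r (fun k => c k θ φ) (fun k => lapS2 (c k) θ φ) N
    fun k hk => hrec k hk θ hθ φ, hr1, hr2, hθ1, hθ2, hφ2]
  simp only [Λ, Finset.mul_sum, ← Finset.sum_add_distrib]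
  refine Finset.sum_congr rfl fun k _ => ?_
  rw [← radial_helmholtz_exp hr, lapS2]
  ring
end
end
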